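/- Expansion of a twisted Dirichlet polynomial into Dirichlet characters: Let f : ℕ → ℂ be finitely supported, let q be a positive integer, and let a be an integer coprime to q. Then for every complex number s with Re(s) = 1/2, one has |D[f·e(a·/q)](s)| ≤ (d₂(q)/√q) ∑_{q = q₀q₁} ∑_{χ mod q₁} |D[f](s, χ, q₀)|, where the outer sum is over all factorizations of q into positive integers q₀, q₁, and f·e(a·/q) denotes the function n ↦ f(n) e(an/q). -/

import Mathlib

open scoped BigOperators
open Real

/-- `e(x) = e^{2πix}`. -/
noncomputable def eR (x : ℝ) : ℂ := Complex.exp (2 * Real.pi * Complex.I * x)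

/-- The Dirichlet polynomial `D[g](s) = ∑_n g(n) n^{-s}`. -/
noncomputable def dirPoly (g : ℕ → ℂ) (s : ℂ) : ℂ := ∑ᶠ n : ℕ, g n / (n : ℂ) ^ s

/-- The twisted Dirichlet polynomial `D[f](s, χ, q₀) = ∑_n f(q₀n) χ(n) n^{-s}`. -/
noncomputable def dirPolyChar (f : ℕ → ℂ) (s : ℂ) {q₁ : ℕ}
    (χ : DirichletCharacter ℂ q₁) (q₀ : ℕ) : ℂ :=
  ∑ᶠ n : ℕ, f (q₀ * n) * χ (n : ZMod q₁) / (n : ℂ) ^ s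

open ComplexConjugate in
/-- Parseval's identity on `ZMod N`. -/
theorem sum_norm_sq_sum_mul_stdAddChar {N : ℕ} [NeZero N] (F : ZMod N → ℂ) :
    ∑ a, ‖∑ b, F b * ZMod.stdAddChar (a * b)‖ ^ 2 = N * ∑ b, ‖F b‖ ^ 2 := by
  have key : ∑ a, (∑ b, F b * ZMod.stdAddChar (a * b)) *
      conj (∑ b, F b * ZMod.stdAddChar (a * b)) = (N : ℂ) * ∑ b, F b * conj (F b) := by
    have h : ∀ a : ZMod N, (∑ b, F b * ZMod.stdAddChar (a * b)) *
        conj (∑ b, F b * ZMod.stdAddChar (a * b)) =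
        ∑ b, ∑ c, F b * conj (F c) * ZMod.stdAddChar (a * (b - c)) := by
      intro a
      rw [map_sum, Finset.sum_mul_sum]
      refine Finset.sum_congr rfl fun b _ ↦ Finset.sum_congr rfl fun c _ ↦ ?_
      rw [map_mul (starRingEnd ℂ), ← AddChar.map_neg_eq_conj, mul_sub, sub_eq_add_neg,
        AddChar.map_add_eq_mul]
      ring
    simp_rw [h]
    rw [Finset.sum_comm, Finset.mul_sum]
    refine Finset.sum_congr rfl fun b _ ↦ ?_
    rw [Finset.sum_comm]
    simp_rw [← Finset.mul_sum,
      AddChar.sum_mulShift _ (ZMod.isPrimitive_stdAddChar N), sub_eq_zero]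
    simp [mul_comm]
  simp_rw [Complex.mul_conj'] at key
  exact_mod_cast key

theorem sum_norm_sq_dirichletCharacter {N : ℕ} [NeZero N] (χ : DirichletCharacter ℂ N) :
    ∑ b, ‖χ b‖ ^ 2 = N.totient := by
  have h : ∀ b : ZMod N, ‖χ b‖ ^ 2 = (1 : MulChar (ZMod N) ℝ) b := by
    intro b
    by_cases hb : IsUnit b
    · rw [← hb.unit_spec, χ.unit_norm_eq_one, one_pow, MulChar.one_apply_coe]
    · simp [MulChar.map_nonunit _ hb]
  simp_rw [h]
  rw [MulChar.sum_one_eq_card_units, ZMod.card_units_eq_totient]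

/-- Any Gauss sum modulo `N`, primitive or not, has absolute value at most `√N`. -/
theorem norm_gaussSum_mulShift_le {N : ℕ} [NeZero N] (χ : DirichletCharacter ℂ N)
    (u : (ZMod N)ˣ) :
    ‖gaussSum χ (AddChar.mulShift ZMod.stdAddChar (u : ZMod N))‖ ≤ √N := by
  have hnorm : ∀ v : (ZMod N)ˣ,
      ‖gaussSum χ (AddChar.mulShift ZMod.stdAddChar (v : ZMod N))‖ =
        ‖gaussSum χ ZMod.stdAddChar‖ := by
    intro v
    rw [gaussSum_mulShift_eq, norm_mul, DirichletCharacter.unit_norm_eq_one, one_mul]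
  rw [hnorm]
  have hpars := sum_norm_sq_sum_mul_stdAddChar (fun b ↦ χ b)
  rw [sum_norm_sq_dirichletCharacter] at hpars
  have hle : ∑ v : (ZMod N)ˣ, ‖∑ b, χ b * ZMod.stdAddChar ((v : ZMod N) * b)‖ ^ 2 ≤
      ∑ a, ‖∑ b, χ b * ZMod.stdAddChar (a * b)‖ ^ 2 := by
    refine (Finset.sum_map Finset.univ ⟨_, Units.val_injective⟩
      (fun a : ZMod N ↦ ‖∑ b, χ b * ZMod.stdAddChar (a * b)‖ ^ 2)).symm.trans_le ?_
    exact Finset.sum_le_sum_of_subset_of_nonneg (Finset.subset_univ _)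
      fun _ _ _ ↦ sq_nonneg _
  have hconst : ∀ v : (ZMod N)ˣ, ‖∑ b, χ b * ZMod.stdAddChar ((v : ZMod N) * b)‖ =
      ‖gaussSum χ ZMod.stdAddChar‖ := fun v ↦ by
    rw [← hnorm v]
    simp [gaussSum]
  simp_rw [hconst] at hle
  rw [hpars, Finset.sum_const, Finset.card_univ, ZMod.card_units_eq_totient, nsmul_eq_mul,
    mul_comm] at hle
  have hφ : (0 : ℝ) < N.totient := by exact_mod_cast Nat.totient_pos.2 (NeZero.pos N)
  exact Real.le_sqrt_of_sq_le (le_of_mul_le_mul_right hle hφ)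

/-- Expansion of an additive character on units into Dirichlet characters. -/
theorem sum_gaussSum_mul_inv_apply {N : ℕ} [NeZero N] (ψ : AddChar (ZMod N) ℂ) (m : ZMod N) :
    ∑ χ : DirichletCharacter ℂ N, gaussSum χ ψ * χ⁻¹ m =
      open Classical in if IsUnit m then N.totient * ψ m else 0 := by
  split_ifs with hm
  · have h : ∀ χ : DirichletCharacter ℂ N,
        gaussSum χ ψ * χ⁻¹ m = ∑ b, χ m⁻¹ * χ b * ψ b := by
      intro χ
      rw [gaussSum, Finset.sum_mul]
      refine Finset.sum_congr rfl fun b _ ↦ ?_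
      rw [MulChar.inv_apply, ← hm.unit_spec, Ring.inverse_unit, ZMod.inv_coe_unit]
      ring
    simp_rw [h]
    rw [Finset.sum_comm]
    simp_rw [← Finset.sum_mul, DirichletCharacter.sum_char_inv_mul_char_eq ℂ hm]
    simp
  · exact Finset.sum_eq_zero fun χ _ ↦ by rw [MulChar.map_nonunit _ hm, mul_zero]

theorem le_card_divisors_mul_totient (n : ℕ) : n ≤ n.divisors.card * n.totient := by
  rcases n.eq_zero_or_pos with rfl | hn
  · simp
  · calc n = ∑ d ∈ n.divisors, d.totient := (Nat.sum_totient n).symm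
      _ ≤ ∑ _d ∈ n.divisors, n.totient := Finset.sum_le_sum fun d hd ↦
          Nat.le_of_dvd (Nat.totient_pos.2 hn)
            (Nat.totient_dvd_of_dvd (Nat.dvd_of_mem_divisors hd))
      _ = n.divisors.card * n.totient := by simp

theorem eR_intCast_mul_natCast_div (N : ℕ) [NeZero N] (a : ℤ) (m : ℕ) :
    eR ((a : ℝ) * m / N) = ZMod.stdAddChar ((a : ZMod N) * (m : ZMod N)) := by
  have h := ZMod.stdAddChar_coe (N := N) (a * m)
  push_cast at h
  rw [h, eR]
  push_cast
  congr 1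
  ring

theorem dirPoly_eq_sum_range {g : ℕ → ℂ} {K : ℕ} (hK : Function.support g ⊆ Finset.range K)
    (s : ℂ) : dirPoly g s = ∑ n ∈ Finset.range K, g n / (n : ℂ) ^ s := by
  refine finsum_eq_sum_of_support_subset _ fun n hn ↦ hK fun h ↦ hn ?_
  simp [h]

theorem dirPolyChar_eq_sum_range {f : ℕ → ℂ} {K : ℕ}
    (hK : Function.support f ⊆ Finset.range K) (s : ℂ) {q₁ : ℕ} (χ : DirichletCharacter ℂ q₁)
    {q₀ : ℕ} (hq₀ : 0 < q₀) :
    dirPolyChar f s χ q₀ =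
      ∑ n ∈ Finset.range K, f (q₀ * n) * χ (n : ZMod q₁) / (n : ℂ) ^ s := by
  refine finsum_eq_sum_of_support_subset _ fun n hn ↦ ?_
  have h : q₀ * n ∈ (Finset.range K : Set ℕ) := hK fun h ↦ hn (by simp [h])
  simp only [Finset.coe_range, Set.mem_Iio] at h ⊢
  exact (Nat.le_mul_of_pos_left n hq₀).trans_lt h

/-- Sorting the positive integers by their greatest common divisor with `q`. -/
theorem sum_range_eq_sum_divisorsAntidiagonal {q : ℕ} (hq : 0 < q) {K : ℕ} (g : ℕ → ℂ)
    (hg₀ : g 0 = 0) (hg : ∀ n, K ≤ n → g n = 0) :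
    ∑ n ∈ Finset.range K, g n =
      ∑ p ∈ Nat.divisorsAntidiagonal q, ∑ m ∈ Finset.range K,
        if m.Coprime p.2 then g (p.1 * m) else 0 := by
  have hcollapse : ∀ p ∈ Nat.divisorsAntidiagonal q, ∀ m ∈ Finset.range K,
      (if m.Coprime p.2 then g (p.1 * m) else 0) =
        ∑ n ∈ Finset.range K, if n = p.1 * m ∧ m.Coprime p.2 then g n else 0 := by
    intro p _ m _
    by_cases hm : m.Coprime p.2
    · rw [if_pos hm, Finset.sum_eq_single (p.1 * m) (fun n _ hn ↦ if_neg fun h ↦ hn h.1)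
        (fun h ↦ by rw [if_pos ⟨rfl, hm⟩, hg _ (not_lt.1 (mt Finset.mem_range.2 h))]),
        if_pos ⟨rfl, hm⟩]
    · simp [hm]
  rw [Finset.sum_congr rfl fun p hp ↦ Finset.sum_congr rfl (hcollapse p hp)]
  rw [Finset.sum_congr rfl fun p _ ↦ Finset.sum_comm, Finset.sum_comm]
  refine Finset.sum_congr rfl fun n hn ↦ ?_
  rcases n.eq_zero_or_pos with rfl | hnpos
  · simp [hg₀]
  have hd : 0 < n.gcd q := Nat.gcd_pos_of_pos_right _ hq
  rw [Finset.sum_eq_single (n.gcd q, q / n.gcd q), Finset.sum_eq_single (n / n.gcd q), if_pos]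
  · exact ⟨(Nat.mul_div_cancel' (Nat.gcd_dvd_left n q)).symm,
      Nat.coprime_div_gcd_div_gcd hd⟩
  · intro m _ hm
    rw [if_neg]
    rintro ⟨h, -⟩
    exact hm (Nat.eq_div_of_mul_eq_right hd.ne' h.symm)
  · intro h
    exact absurd (Finset.mem_range.2 ((Nat.div_le_self _ _).trans_lt (Finset.mem_range.1 hn))) h
  · rintro ⟨d, e⟩ hp hne
    obtain ⟨rfl, -⟩ := Nat.mem_divisorsAntidiagonal.1 hp
    refine Finset.sum_eq_zero fun m _ ↦ if_neg ?_
    rintro ⟨rfl, hm⟩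
    have hd0 : 0 < d := Nat.pos_of_mul_pos_right hnpos
    refine hne ?_
    dsimp only at hm
    rw [Nat.gcd_mul_left, hm.gcd_eq_one, mul_one, Nat.mul_div_cancel_left _ hd0]
  · intro h
    exact absurd (Nat.mem_divisorsAntidiagonal.2
      ⟨Nat.mul_div_cancel' (Nat.gcd_dvd_right n q), hq.ne'⟩) h

/-- The twist by `e(a·/N)` restricted to integers coprime to `N`, in terms of characters. -/
theorem sum_coprime_eq_sum_dirPolyChar {f : ℕ → ℂ} {K : ℕ}
    (hK : Function.support f ⊆ Finset.range K) (s : ℂ) {d N : ℕ} (hd : 0 < d) [NeZero N]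
    (a : ℤ) :
    (∑ m ∈ Finset.range K, if m.Coprime N then
      f (d * m) * eR ((a : ℝ) * ((d * m : ℕ) : ℝ) / ((d * N : ℕ) : ℝ)) /
        ((d * m : ℕ) : ℂ) ^ s else 0) =
      ((d : ℂ) ^ s)⁻¹ * (N.totient : ℂ)⁻¹ * ∑ χ : DirichletCharacter ℂ N,
        gaussSum χ (AddChar.mulShift ZMod.stdAddChar (a : ZMod N)) * dirPolyChar f s χ⁻¹ d := by
  have hφ : (N.totient : ℂ) ≠ 0 := by exact_mod_cast (Nat.totient_pos.2 (NeZero.pos N)).ne'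
  have hswap : ∑ χ : DirichletCharacter ℂ N,
        gaussSum χ (AddChar.mulShift ZMod.stdAddChar (a : ZMod N)) * dirPolyChar f s χ⁻¹ d =
      ∑ m ∈ Finset.range K, f (d * m) / (m : ℂ) ^ s * ∑ χ : DirichletCharacter ℂ N,
        gaussSum χ (AddChar.mulShift ZMod.stdAddChar (a : ZMod N)) * χ⁻¹ (m : ZMod N) := by
    simp_rw [dirPolyChar_eq_sum_range hK s _ hd, Finset.mul_sum]
    rw [Finset.sum_comm]
    refine Finset.sum_congr rfl fun m _ ↦ Finset.sum_congr rfl fun χ _ ↦ ?_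
    ring
  rw [hswap, Finset.mul_sum]
  refine Finset.sum_congr rfl fun m _ ↦ ?_
  rw [sum_gaussSum_mul_inv_apply]
  simp only [ZMod.isUnit_iff_coprime]
  split_ifs with hm
  · have hd' : (d : ℝ) ≠ 0 := by exact_mod_cast hd.ne'
    have harg : (a : ℝ) * ((d * m : ℕ) : ℝ) / ((d * N : ℕ) : ℝ) = (a : ℝ) * m / N := by
      push_cast
      rw [mul_left_comm, mul_div_mul_left _ _ hd']
    rw [harg, eR_intCast_mul_natCast_div, AddChar.mulShift_apply, Nat.cast_mul,
      Complex.natCast_mul_natCast_cpow]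
    field_simp
  · simp

/-- **Expansion of a twisted Dirichlet polynomial into Dirichlet characters.** -/
theorem dirichlet_polynomial_character_expansion
    (f : ℕ → ℂ) (hf : (Function.support f).Finite)
    (q : ℕ) (hq : 1 ≤ q) (a : ℤ) (ha : Int.gcd a q = 1)
    (s : ℂ) (hs : s.re = 1 / 2) :
    ‖dirPoly (fun n => f n * eR ((a : ℝ) * (n : ℝ) / (q : ℝ))) s‖
      ≤ (q.divisors.card : ℝ) / Real.sqrt q *
        ∑ p ∈ Nat.divisorsAntidiagonal q,
          ∑ᶠ χ : DirichletCharacter ℂ p.2, ‖dirPolyChar f s χ p.1‖ := by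
  obtain ⟨K, hK⟩ : ∃ K, Function.support f ⊆ Finset.range K := by
    obtain ⟨B, hB⟩ := hf.bddAbove
    exact ⟨B + 1, fun n hn ↦ by simpa using Nat.lt_succ_of_le (hB hn)⟩
  have hs₀ : s ≠ 0 := by
    rintro rfl
    norm_num at hs
  rw [dirPoly_eq_sum_range ((Function.support_mul_subset_left _ _).trans hK) s,
    sum_range_eq_sum_divisorsAntidiagonal hq
      (fun n ↦ f n * eR ((a : ℝ) * (n : ℝ) / (q : ℝ)) / (n : ℂ) ^ s) (by simp [hs₀])
      (fun n hn ↦ ?_), Finset.mul_sum]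
  · refine norm_sum_le_of_le _ ?_
    rintro ⟨d, N⟩ hp
    obtain ⟨rfl, hdN⟩ := Nat.mem_divisorsAntidiagonal.1 hp
    simp only at hdN ha hq ⊢
    have hd : 0 < d := Nat.pos_of_mul_pos_right hq
    have hN : 0 < N := Nat.pos_of_mul_pos_left hq
    have : NeZero N := ⟨hN.ne'⟩
    rw [sum_coprime_eq_sum_dirPolyChar hK s hd a, finsum_eq_sum_of_fintype]
    have hcop : IsUnit (a : ZMod N) := by
      rw [ZMod.coe_int_isUnit_iff_isCoprime]
      have h := Int.isCoprime_iff_gcd_eq_one.2 ha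
      push_cast at h
      exact h.of_mul_right_right.symm
    have hsum : ‖∑ χ : DirichletCharacter ℂ N,
        gaussSum χ (AddChar.mulShift ZMod.stdAddChar (a : ZMod N)) * dirPolyChar f s χ⁻¹ d‖ ≤
        √N * ∑ χ : DirichletCharacter ℂ N, ‖dirPolyChar f s χ d‖ := by
      rw [← Equiv.sum_comp (Equiv.inv (DirichletCharacter ℂ N)), Finset.mul_sum]
      refine norm_sum_le_of_le _ fun χ _ ↦ ?_
      rw [norm_mul]
      gcongr
      · simpa using norm_gaussSum_mulShift_le χ⁻¹ hcop.unit
      · simp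
    have hφ : (0 : ℝ) < N.totient := by exact_mod_cast Nat.totient_pos.2 hN
    have hcoef : (√d)⁻¹ * (N.totient : ℝ)⁻¹ * √N ≤
        ((d * N).divisors.card : ℝ) / √((d * N : ℕ) : ℝ) := by
      have hd' : 0 < √(d : ℝ) := Real.sqrt_pos.2 (by exact_mod_cast hd)
      have hN' : 0 < √(N : ℝ) := Real.sqrt_pos.2 (by exact_mod_cast hN)
      have hle : (N : ℝ) ≤ (d * N).divisors.card * N.totient := by
        exact_mod_cast (le_card_divisors_mul_totient N).trans (Nat.mul_le_mul_right _
          (Finset.card_le_card (Nat.divisors_subset_of_dvd hdN (Nat.dvd_mul_left N d))))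
      rw [Nat.cast_mul d N, Real.sqrt_mul (Nat.cast_nonneg d), le_div_iff₀ (by positivity)]
      calc (√d)⁻¹ * (N.totient : ℝ)⁻¹ * √N * (√d * √N)
          = (√N * √N) / N.totient := by field_simp
        _ = N / N.totient := by rw [Real.mul_self_sqrt (Nat.cast_nonneg N)]
        _ ≤ (d * N).divisors.card := (div_le_iff₀ hφ).2 hle
    rw [norm_mul, norm_mul, norm_inv, norm_inv, Complex.norm_natCast_cpow_of_pos hd, hs,
      ← Real.sqrt_eq_rpow, Complex.norm_natCast]
    calc _ ≤ (√d)⁻¹ * (N.totient : ℝ)⁻¹ *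
          (√N * ∑ χ : DirichletCharacter ℂ N, ‖dirPolyChar f s χ d‖) := by gcongr
      _ = (√d)⁻¹ * (N.totient : ℝ)⁻¹ * √N *
          ∑ χ : DirichletCharacter ℂ N, ‖dirPolyChar f s χ d‖ := by ring
      _ ≤ _ := by gcongr
  · have h : f n = 0 := by
      by_contra h
      exact absurd (Finset.mem_range.1 (hK h)) (not_lt.2 hn)
    simp [h]
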